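/- arXiv:math/0601301 — 6 statements merged into one kernel-verified Lean document; each statement's English description precedes it below -/
import Mathlib

section
/- Let (V, b, δ) be a finite-dimensional Lie bialgebra over a field K of characteristic zero. Then there exists a bilinear, alternating bracket B on g = V × V* satisfying the Jacobi identity (so that (g, B) is a Lie algebra) such that: (i) B((x,0),(y,0)) = (b(x,y), 0) for all x, y ∈ V; (ii) B((0,ξ),(0,η)) = (0, ⁅ξ,η⁆_δ) for all ξ, η ∈ V*, where ⁅ξ,η⁆_δ(v) = (ξ ⊗ η)(δ v); and (iii) the canonical symmetric form ⟨(x,ξ),(y,η)⟩ = ξ(y) + η(x) is invariant for B. In particular (V ⊕ V*, V, V*) is a Manin triple: V × {0} and {0} × V* are Lagrangian Lie subalgebras of (g, B). -/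
open TensorProduct

noncomputable section

variable (K : Type*) [Field K] (M : Type*) [AddCommGroup M] [Module K M]

/-- The flip map `τ : u ⊗ v ↦ v ⊗ u` on `M ⊗ M`. -/
def tauMap : M ⊗[K] M →ₗ[K] M ⊗[K] M := (TensorProduct.comm K M M).toLinearMap

/-- The cyclic permutation `σ : a ⊗ b ⊗ c ↦ b ⊗ c ⊗ a` on `M ⊗ M ⊗ M`. -/
def sigmaMap : M ⊗[K] (M ⊗[K] M) →ₗ[K] M ⊗[K] (M ⊗[K] M) :=
  (TensorProduct.assoc K M M M).toLinearMap ∘ₗ (TensorProduct.comm K M (M ⊗[K] M)).toLinearMap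

variable {K M}

/-- `δ ⊗ id`, regarded as a map `M ⊗ M → M ⊗ (M ⊗ M)`. -/
def deltaExt (δ : M →ₗ[K] M ⊗[K] M) : M ⊗[K] M →ₗ[K] M ⊗[K] (M ⊗[K] M) :=
  (TensorProduct.assoc K M M M).toLinearMap ∘ₗ LinearMap.rTensor M δ

/-- co-antisymmetry of a cobracket: `τ ∘ δ = -δ`. -/
def CoAnti (δ : M →ₗ[K] M ⊗[K] M) : Prop := tauMap K M ∘ₗ δ = -δ

/-- The co-Jacobi identity `(1 + σ + σ²) ∘ (δ ⊗ id) ∘ δ = 0`. -/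
def CoJacobi (δ : M →ₗ[K] M ⊗[K] M) : Prop :=
  (LinearMap.id + sigmaMap K M + sigmaMap K M ∘ₗ sigmaMap K M) ∘ₗ deltaExt δ ∘ₗ δ = 0

/-- The adjoint action of `x` on `M ⊗ M`: `x · (u ⊗ v) = b x u ⊗ v + u ⊗ b x v`. -/
def adT (b : M →ₗ[K] M →ₗ[K] M) (x : M) : M ⊗[K] M →ₗ[K] M ⊗[K] M :=
  LinearMap.rTensor M (b x) + LinearMap.lTensor M (b x)

/-- The 1-cocycle condition: `δ (b x y) = x · δ y - y · δ x`. -/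
def Cocycle (b : M →ₗ[K] M →ₗ[K] M) (δ : M →ₗ[K] M ⊗[K] M) : Prop :=
  ∀ x y : M, δ (b x y) = adT b x (δ y) - adT b y (δ x)

/-- `b` is a Lie bracket: alternating and satisfying the Jacobi identity. -/
def IsLieBracket (b : M →ₗ[K] M →ₗ[K] M) : Prop :=
  (∀ x : M, b x x = 0) ∧ ∀ x y z : M, b (b x y) z + b (b y z) x + b (b z x) y = 0

/-- The dual bracket `⁅ξ, η⁆ (v) = (ξ ⊗ η) (δ v)` on the dual space. -/
def dualBracketL (δ : M →ₗ[K] M ⊗[K] M) :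
    Module.Dual K M →ₗ[K] Module.Dual K M →ₗ[K] Module.Dual K M :=
  (TensorProduct.mk K (Module.Dual K M) (Module.Dual K M)).compr₂
    (δ.dualMap ∘ₗ TensorProduct.dualDistrib K M M)

/-- The canonical symmetric form `⟨(x,ξ),(y,η)⟩ = ξ y + η x` on `M × M*`. -/
def canForm (u v : M × Module.Dual K M) : K := u.2 v.1 + v.2 u.1

variable (K M) in
/-- A submodule `S` of `M × M*` is Lagrangian for the canonical symmetric form:
isotropic and maximal isotropic. -/
def IsLagrangian (S : Submodule K (M × Module.Dual K M)) : Prop :=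
  (∀ u ∈ S, ∀ v ∈ S, canForm u v = 0) ∧
  (∀ u : M × Module.Dual K M, (∀ v ∈ S, canForm u v = 0) → u ∈ S)


/-- contraction `C ξ x = (ξ ⊗ id) (δ x)` -/
def contrC (δ : M →ₗ[K] M ⊗[K] M) : Module.Dual K M →ₗ[K] M →ₗ[K] M :=
  LinearMap.mk₂ K (fun ξ x => TensorProduct.lid K M (LinearMap.rTensor M ξ (δ x)))
    (by intro a b c; simp [LinearMap.rTensor_add])
    (by intro a b c; simp [LinearMap.rTensor_smul])
    (by intro a b c; simp) (by intro a b c; simp)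

/-- transpose action `A x ξ = ξ ∘ b x` -/
def trA (b : M →ₗ[K] M →ₗ[K] M) : M →ₗ[K] Module.Dual K M →ₗ[K] Module.Dual K M :=
  LinearMap.mk₂ K (fun x ξ => ξ ∘ₗ b x)
    (by intro a b c; ext; simp) (by intro a b c; ext; simp)
    (by intro a b c; ext; simp) (by intro a b c; ext; simp)

theorem trA_apply (b : M →ₗ[K] M →ₗ[K] M) (x z : M) (ξ : Module.Dual K M) :
    trA b x ξ z = ξ (b x z) := rfl

theorem dualB_apply (δ : M →ₗ[K] M ⊗[K] M) (ξ η : Module.Dual K M) (x : M) :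
    dualBracketL δ ξ η x = TensorProduct.dualDistrib K M M (ξ ⊗ₜ η) (δ x) := rfl

theorem contrC_apply (δ : M →ₗ[K] M ⊗[K] M) (ξ ζ : Module.Dual K M) (x : M) :
    ζ (contrC δ ξ x) = dualBracketL δ ξ ζ x := by
  rw [dualB_apply]
  change ζ (TensorProduct.lid K M (LinearMap.rTensor M ξ (δ x))) = _
  induction δ x using TensorProduct.induction_on with
  | zero => simp
  | tmul a c => simp
  | add a c ha hc => simp only [map_add, ha, hc]

theorem dualB_anti (δ : M →ₗ[K] M ⊗[K] M) (h : CoAnti δ) (ξ η : Module.Dual K M) (x : M) :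
    dualBracketL δ ξ η x = - dualBracketL δ η ξ x := by
  have h1 : tauMap K M (δ x) = - δ x := LinearMap.congr_fun h x
  rw [dualB_apply, dualB_apply, ← map_neg, ← h1]
  induction δ x using TensorProduct.induction_on with
  | zero => simp
  | tmul a c => simp [tauMap, mul_comm]
  | add a c ha hc => simp only [map_add, ha, hc]

theorem dualB_cocycle (b : M →ₗ[K] M →ₗ[K] M) (δ : M →ₗ[K] M ⊗[K] M) (h : Cocycle b δ)
    (ξ η : Module.Dual K M) (x y : M) :
    dualBracketL δ ξ η (b x y) =
      dualBracketL δ (trA b x ξ) η y + dualBracketL δ ξ (trA b x η) y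
      - dualBracketL δ (trA b y ξ) η x - dualBracketL δ ξ (trA b y η) x := by
  have key : ∀ (x : M) (t : M ⊗[K] M), TensorProduct.dualDistrib K M M (ξ ⊗ₜ η) (adT b x t) =
      TensorProduct.dualDistrib K M M (trA b x ξ ⊗ₜ η) t
      + TensorProduct.dualDistrib K M M (ξ ⊗ₜ trA b x η) t := by
    intro x t
    induction t using TensorProduct.induction_on with
    | zero => simp
    | tmul a c => simp [adT, trA_apply]
    | add a c ha hc => simp only [map_add, ha, hc]; ring
  simp only [dualB_apply]
  rw [h x y, map_sub, key, key]
  ring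

theorem dualB_jacobi (δ : M →ₗ[K] M ⊗[K] M) (ha : CoAnti δ) (h : CoJacobi δ)
    (ξ η ζ : Module.Dual K M) (x : M) :
    dualBracketL δ ξ (dualBracketL δ η ζ) x + dualBracketL δ η (dualBracketL δ ζ ξ) x
      + dualBracketL δ ζ (dualBracketL δ ξ η) x = 0 := by
  have h1 := LinearMap.congr_fun h x
  simp only [LinearMap.comp_apply, LinearMap.add_apply, LinearMap.id_apply,
    LinearMap.zero_apply] at h1
  let T : Module.Dual K M → Module.Dual K M → Module.Dual K M → M ⊗[K] (M ⊗[K] M) →ₗ[K] K :=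
    fun α β γ => TensorProduct.dualDistrib K M (M ⊗[K] M)
      (α ⊗ₜ TensorProduct.dualDistrib K M M (β ⊗ₜ γ))
  have hs : ∀ α β γ t, T α β γ (sigmaMap K M t) = T γ α β t := by
    intro α β γ t
    induction t using TensorProduct.induction_on with
    | zero => simp
    | add a c ha hc => simp only [map_add, ha, hc]
    | tmul a s =>
      induction s using TensorProduct.induction_on with
      | zero => simp
      | add p q hp hq => simp only [map_add, TensorProduct.tmul_add, hp, hq]
      | tmul p q => simp [T, sigmaMap]; ring
  have hassoc : ∀ α β γ (s : M ⊗[K] M) (c : M), T α β γ (TensorProduct.assoc K M M M (s ⊗ₜ c)) =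
      TensorProduct.dualDistrib K M M (α ⊗ₜ β) s * γ c := by
    intro α β γ s c
    induction s using TensorProduct.induction_on with
    | zero => simp
    | add p q hp hq => simp only [map_add, TensorProduct.add_tmul, hp, hq, add_mul]
    | tmul p q => simp [T]; ring
  have hd : ∀ α β γ t, T α β γ (deltaExt δ t) =
      TensorProduct.dualDistrib K M M (dualBracketL δ α β ⊗ₜ γ) t := by
    intro α β γ t
    induction t using TensorProduct.induction_on with
    | zero => simp
    | add a c ha hc => simp only [map_add, ha, hc]
    | tmul a c =>
      simp only [deltaExt, LinearMap.comp_apply, LinearMap.rTensor_tmul,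
        LinearEquiv.coe_coe, hassoc, TensorProduct.dualDistrib_apply, dualB_apply]
  have h2 := congrArg (T ξ η ζ) h1
  simp only [map_add, hs, hd, map_zero] at h2
  rw [← dualB_apply, ← dualB_apply, ← dualB_apply] at h2
  rw [dualB_anti δ ha ξ, dualB_anti δ ha η, dualB_anti δ ha ζ]
  linear_combination -h2

/-- the bracket of the double -/
def dblB (b : M →ₗ[K] M →ₗ[K] M) (δ : M →ₗ[K] M ⊗[K] M) :
    (M × Module.Dual K M) →ₗ[K] (M × Module.Dual K M) →ₗ[K] (M × Module.Dual K M) :=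
  LinearMap.mk₂ K (fun u v =>
    (b u.1 v.1 - contrC δ u.2 v.1 + contrC δ v.2 u.1,
     dualBracketL δ u.2 v.2 - trA b u.1 v.2 + trA b v.1 u.2))
    (by
      intro u v w
      ext1 <;> simp only [map_add, LinearMap.add_apply, Prod.fst_add, Prod.snd_add] <;> abel)
    (by
      intro c v w
      ext1 <;> simp only [map_smul, LinearMap.smul_apply, Prod.smul_fst, Prod.smul_snd,
        smul_add, smul_sub])
    (by
      intro u v w
      ext1 <;> simp only [map_add, LinearMap.add_apply, Prod.fst_add, Prod.snd_add] <;> abel)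
    (by
      intro c v w
      ext1 <;> simp only [map_smul, LinearMap.smul_apply, Prod.smul_fst, Prod.smul_snd,
        smul_add, smul_sub])

theorem dblB_apply (b : M →ₗ[K] M →ₗ[K] M) (δ : M →ₗ[K] M ⊗[K] M)
    (u v : M × Module.Dual K M) : dblB b δ u v =
    (b u.1 v.1 - contrC δ u.2 v.1 + contrC δ v.2 u.1,
     dualBracketL δ u.2 v.2 - trA b u.1 v.2 + trA b v.1 u.2) := rfl

theorem bracket_skew (b : M →ₗ[K] M →ₗ[K] M) (hb : IsLieBracket b) (x y : M) :
    b x y = - b y x := by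
  have h := hb.1 (x + y)
  simp only [map_add, LinearMap.add_apply, hb.1, zero_add, add_zero] at h
  exact eq_neg_of_add_eq_zero_right h

theorem dblB_jacobi (b : M →ₗ[K] M →ₗ[K] M) (δ : M →ₗ[K] M ⊗[K] M)
    (hb : IsLieBracket b) (hanti : CoAnti δ) (hcojac : CoJacobi δ) (hcoc : Cocycle b δ)
    (u v w : M × Module.Dual K M) :
    dblB b δ (dblB b δ u v) w + dblB b δ (dblB b δ v w) u + dblB b δ (dblB b δ w u) v = 0 := by
  obtain ⟨x, ξ⟩ := u
  obtain ⟨y, η⟩ := v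
  obtain ⟨z, ζ⟩ := w
  have h1 : ∀ (α β : Module.Dual K M) (p q : M),
      β (b (contrC δ α p) q) = - dualBracketL δ α (trA b q β) p := by
    intro α β p q
    rw [bracket_skew b hb, map_neg, ← trA_apply, contrC_apply]
  have h2 : ∀ (α β : Module.Dual K M) (p q : M),
      β (b q (contrC δ α p)) = dualBracketL δ α (trA b q β) p := by
    intro α β p q
    rw [← trA_apply, contrC_apply]
  have hj : ∀ (α : Module.Dual K M) (p q r : M),
      α (b (b p q) r) = α (b p (b q r)) - α (b q (b p r)) := by
    intro α p q r
    have := congrArg α (hb.2 p q r)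
    rw [bracket_skew b hb (b q r) p, bracket_skew b hb (b r p) q, bracket_skew b hb r p] at this
    simp only [map_add, map_neg, map_zero] at this
    linear_combination this
  have hco := dualB_cocycle b δ hcoc
  have hJ := dualB_jacobi δ hanti hcojac
  have hA := dualB_anti δ hanti
  have hL : ∀ (α β γ : Module.Dual K M) (p : M), dualBracketL δ (dualBracketL δ α β) γ p =
      dualBracketL δ α (dualBracketL δ β γ) p - dualBracketL δ β (dualBracketL δ α γ) p := by
    intro α β γ p
    have e : dualBracketL δ γ α = - dualBracketL δ α γ := by
      ext t; exact hA γ α t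
    have := hJ α β γ p
    rw [e, map_neg, LinearMap.neg_apply] at this
    rw [hA]
    linear_combination -this
  have hbs := bracket_skew b hb
  have hAf : ∀ α β, dualBracketL δ α β = - dualBracketL δ β α := by
    intro α β; ext t; exact hA α β t
  ext1
  · refine (Module.forall_dual_apply_eq_zero_iff K _).1 fun α => ?_
    simp only [dblB_apply, Prod.fst_add, map_add, map_sub, LinearMap.add_apply,
      LinearMap.sub_apply, h1, h2, hj, contrC_apply, hco, hL]
    simp only [hbs y x, hbs z x, hbs z y, hAf η ξ, hAf ζ ξ, hAf ζ η, map_neg,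
      LinearMap.neg_apply]
    have e := hj α x y z
    rw [hbs (b x y) z, map_neg] at e
    linear_combination -2 * e
  · ext t
    simp only [dblB_apply, Prod.snd_add, map_add, map_sub, LinearMap.add_apply,
      LinearMap.sub_apply, h1, h2, hj, contrC_apply, hco, hL, trA_apply, Prod.snd_zero,
      LinearMap.zero_apply]
    simp only [hbs y x, hbs z x, hbs z y, hAf η ξ, hAf ζ ξ, hAf ζ η, map_neg,
      LinearMap.neg_apply]
    have e := hL ξ η ζ t
    rw [hA (dualBracketL δ ξ η) ζ t] at e
    linear_combination -2 * e + hA (trA b y ξ) ζ t + hA (trA b z η) ξ t + hA (trA b x ζ) η t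
      - hA (trA b t ζ) ξ y - hA (trA b t ξ) η z - hA (trA b t η) ζ x

/-- A finite-dimensional Lie bialgebra `(V, b, δ)` over a field of
characteristic zero gives rise to a Lie bracket `B` on `g = V × V*` restricting to `b` on
`V × {0}` and to the dual bracket of `δ` on `{0} × V*`, for which the canonical symmetric
form is invariant.  In particular `(V ⊕ V*, V, V*)` is a Manin triple: `V × {0}` and
`{0} × V*` are Lagrangian Lie subalgebras of `(g, B)`. -/
theorem statement0 {K : Type*} [Field K] [CharZero K] {V : Type*} [AddCommGroup V]
    [Module K V] [FiniteDimensional K V]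
    (b : V →ₗ[K] V →ₗ[K] V) (δ : V →ₗ[K] V ⊗[K] V)
    (hb : IsLieBracket b) (hanti : CoAnti δ) (hcojac : CoJacobi δ) (hcoc : Cocycle b δ) :
    ∃ B : (V × Module.Dual K V) →ₗ[K] (V × Module.Dual K V) →ₗ[K] (V × Module.Dual K V),
      (∀ u, B u u = 0) ∧
      (∀ u v w, B (B u v) w + B (B v w) u + B (B w u) v = 0) ∧
      (∀ x y : V, B (x, 0) (y, 0) = (b x y, 0)) ∧
      (∀ ξ η : Module.Dual K V, B (0, ξ) (0, η) = (0, dualBracketL δ ξ η)) ∧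
      (∀ u v w, canForm (B u v) w = - canForm v (B u w)) ∧
      (∀ u ∈ Submodule.fst K V (Module.Dual K V), ∀ v ∈ Submodule.fst K V (Module.Dual K V),
        B u v ∈ Submodule.fst K V (Module.Dual K V)) ∧
      (∀ u ∈ Submodule.snd K V (Module.Dual K V), ∀ v ∈ Submodule.snd K V (Module.Dual K V),
        B u v ∈ Submodule.snd K V (Module.Dual K V)) ∧
      IsLagrangian K V (Submodule.fst K V (Module.Dual K V)) ∧
      IsLagrangian K V (Submodule.snd K V (Module.Dual K V)) := by
  have hA : ∀ ξ η, dualBracketL δ ξ η = - dualBracketL δ η ξ := by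
    intro ξ η
    ext t
    exact dualB_anti δ hanti ξ η t
  have hA0 : ∀ ξ, dualBracketL δ ξ ξ = 0 := by
    intro ξ
    ext t
    exact self_eq_neg.1 (dualB_anti δ hanti ξ ξ t)
  refine ⟨dblB b δ, ?_, dblB_jacobi b δ hb hanti hcojac hcoc, ?_, ?_, ?_, ?_, ?_, ?_, ?_⟩
  · intro u
    simp [dblB_apply, hb.1, hA0]
  · intro x y
    simp [dblB_apply]
  · intro ξ η
    simp [dblB_apply]
  · rintro ⟨x, ξ⟩ ⟨y, η⟩ ⟨z, ζ⟩
    simp only [dblB_apply, canForm, map_add, map_sub, LinearMap.add_apply,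
      LinearMap.sub_apply, contrC_apply, trA_apply]
    rw [dualB_anti δ hanti ξ η z, dualB_anti δ hanti η ζ x, bracket_skew b hb y z,
      bracket_skew b hb x y]
    rw [bracket_skew b hb y x]
    simp only [map_neg]
    ring
  · rintro ⟨x, ξ⟩ hu ⟨y, η⟩ hv
    simp only [Submodule.fst, Submodule.mem_comap, LinearMap.snd_apply, Submodule.mem_bot] at *
    simp [dblB_apply, hu, hv]
  · rintro ⟨x, ξ⟩ hu ⟨y, η⟩ hv
    simp only [Submodule.snd, Submodule.mem_comap, LinearMap.fst_apply, Submodule.mem_bot] at *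
    simp [dblB_apply, hu, hv]
  · constructor
    · rintro ⟨x, ξ⟩ hu ⟨y, η⟩ hv
      simp only [Submodule.fst, Submodule.mem_comap, LinearMap.snd_apply, Submodule.mem_bot] at *
      simp [canForm, hu, hv]
    · rintro ⟨x, ξ⟩ h
      simp only [Submodule.fst, Submodule.mem_comap, LinearMap.snd_apply, Submodule.mem_bot] at *
      ext y
      simpa [canForm] using h (y, 0) rfl
  · constructor
    · rintro ⟨x, ξ⟩ hu ⟨y, η⟩ hv
      simp only [Submodule.snd, Submodule.mem_comap, LinearMap.fst_apply, Submodule.mem_bot] at *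
      simp [canForm, hu, hv]
    · rintro ⟨x, ξ⟩ h
      simp only [Submodule.snd, Submodule.mem_comap, LinearMap.fst_apply, Submodule.mem_bot] at *
      refine (Module.forall_dual_apply_eq_zero_iff K _).1 fun α => ?_
      simpa [canForm] using h (0, α) rfl
end
end

section
/- Let (V, b, δ) be a finite-dimensional Lie bialgebra over a field K of characteristic zero. Then there exists a bilinear, alternating bracket B on g = V × V* satisfying the Jacobi identity (so that (g, B) is a Lie algebra) such that: (i) B((x,0),(y,0)) = (b(x,y), 0) for all x, y ∈ V; (ii) B((0,ξ),(0,η)) = (0, ⁅ξ,η⁆_δ) for all ξ, η ∈ V*, where ⁅ξ,η⁆_δ(v) = (ξ ⊗ η)(δ v); and (iii) the canonical symmetric form ⟨(x,ξ),(y,η)⟩ = ξ(y) + η(x) is invariant for B. In particular (V ⊕ V*, V, V*) is a Manin triple: V × {0} and {0} × V* are Lie subalgebras of (g, B), each isotropic for the canonical form. -/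
open TensorProduct

noncomputable section

variable (K : Type*) [Field K] (M : Type*) [AddCommGroup M] [Module K M]

variable {K M}

section helpers
variable {K : Type*} [Field K] {V : Type*} [AddCommGroup V] [Module K V]

theorem aux_beta (δ : V →ₗ[K] V ⊗[K] V) (ξ η : Module.Dual K V) (v : V) :
    dualBracketL δ ξ η v = TensorProduct.dualDistrib K V V (ξ ⊗ₜ η) (δ v) := rfl

theorem aux_beta_anti (δ : V →ₗ[K] V ⊗[K] V) (h : CoAnti δ) (ξ η : Module.Dual K V) (v : V) :
    dualBracketL δ ξ η v = - dualBracketL δ η ξ v := by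
  have key : ∀ t : V ⊗[K] V, TensorProduct.dualDistrib K V V (ξ ⊗ₜ η) (tauMap K V t) =
      TensorProduct.dualDistrib K V V (η ⊗ₜ ξ) t := by
    intro t
    induction t using TensorProduct.induction_on with
    | zero => simp
    | tmul a c => simp [tauMap, mul_comm]
    | add a c ha hc => simp only [map_add, ha, hc]
  have h2 : tauMap K V (δ v) = - δ v := LinearMap.congr_fun h v
  rw [aux_beta, aux_beta, ← key, h2, map_neg, neg_neg]

theorem aux_beta_cocycle (b : V →ₗ[K] V →ₗ[K] V) (δ : V →ₗ[K] V ⊗[K] V) (h : Cocycle b δ)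
    (ξ η : Module.Dual K V) (x y : V) :
    dualBracketL δ ξ η (b x y) =
      dualBracketL δ (ξ ∘ₗ b x) η y + dualBracketL δ ξ (η ∘ₗ b x) y
      - dualBracketL δ (ξ ∘ₗ b y) η x - dualBracketL δ ξ (η ∘ₗ b y) x := by
  have key : ∀ (x : V) (t : V ⊗[K] V),
      TensorProduct.dualDistrib K V V (ξ ⊗ₜ η) (adT b x t) =
      TensorProduct.dualDistrib K V V ((ξ ∘ₗ b x) ⊗ₜ η) t +
      TensorProduct.dualDistrib K V V (ξ ⊗ₜ (η ∘ₗ b x)) t := by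
    intro x t
    induction t using TensorProduct.induction_on with
    | zero => simp
    | tmul a c => simp [adT]
    | add a c ha hc => simp only [map_add, ha, hc]; ring
  simp only [aux_beta]
  rw [h x y, map_sub, key, key]
  ring

def auxG (ξ η ζ : Module.Dual K V) : V ⊗[K] (V ⊗[K] V) →ₗ[K] K :=
  TensorProduct.dualDistrib K V (V ⊗[K] V) (ξ ⊗ₜ TensorProduct.dualDistrib K V V (η ⊗ₜ ζ))

theorem auxG_tmul (ξ η ζ : Module.Dual K V) (x y z : V) :
    auxG ξ η ζ (x ⊗ₜ (y ⊗ₜ z)) = ξ x * (η y * ζ z) := by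
  simp [auxG]

theorem auxG_sigma (ξ η ζ : Module.Dual K V) (t : V ⊗[K] (V ⊗[K] V)) :
    auxG ξ η ζ (sigmaMap K V t) = auxG ζ ξ η t := by
  induction t using TensorProduct.induction_on with
  | zero => simp
  | add a c ha hc => simp only [map_add, ha, hc]
  | tmul a s =>
    induction s using TensorProduct.induction_on with
    | zero => simp
    | add p q hp hq => simp only [TensorProduct.tmul_add, map_add, hp, hq]
    | tmul p q => simp [sigmaMap, auxG_tmul]; ring

theorem aux_beta_beta (δ : V →ₗ[K] V ⊗[K] V) (ξ η ζ : Module.Dual K V) (v : V) :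
    dualBracketL δ (dualBracketL δ ξ η) ζ v = auxG ξ η ζ (deltaExt δ (δ v)) := by
  rw [aux_beta]
  generalize δ v = t
  induction t using TensorProduct.induction_on with
  | zero => simp
  | add a c ha hc => simp only [map_add, ha, hc]
  | tmul a c =>
    simp only [TensorProduct.dualDistrib_apply, aux_beta, deltaExt, LinearMap.comp_apply,
      LinearMap.rTensor_tmul]
    generalize δ a = s
    induction s using TensorProduct.induction_on with
    | zero => simp
    | add p q hp hq => simp only [TensorProduct.add_tmul, map_add, add_mul, hp, hq]
    | tmul p q => simp [auxG_tmul]; ring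

theorem aux_beta_jac (δ : V →ₗ[K] V ⊗[K] V) (h : CoJacobi δ) (ξ η ζ : Module.Dual K V) (v : V) :
    dualBracketL δ (dualBracketL δ ξ η) ζ v + dualBracketL δ (dualBracketL δ η ζ) ξ v
      + dualBracketL δ (dualBracketL δ ζ ξ) η v = 0 := by
  have h2 := congrArg (auxG ξ η ζ) (LinearMap.congr_fun h v)
  simp only [LinearMap.comp_apply, LinearMap.add_apply, LinearMap.id_apply, map_add,
    auxG_sigma, LinearMap.zero_apply, map_zero] at h2
  simp only [aux_beta_beta]
  linear_combination h2

/-- `auxC δ ξ x = -(ξ ⊗ id)(δ x)`. -/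
def auxC (δ : V →ₗ[K] V ⊗[K] V) : Module.Dual K V →ₗ[K] V →ₗ[K] V :=
  LinearMap.mk₂ K (fun ξ x => - TensorProduct.lid K V (LinearMap.rTensor V ξ (δ x)))
    (by intro a c x; simp [LinearMap.rTensor_add]; abel)
    (by intro k a x; simp [LinearMap.rTensor_smul])
    (by intro a x y; simp; abel)
    (by intro k a x; simp)

theorem auxC_apply (δ : V →ₗ[K] V ⊗[K] V) (ξ η : Module.Dual K V) (x : V) :
    η (auxC δ ξ x) = - dualBracketL δ ξ η x := by
  rw [aux_beta]
  simp only [auxC, LinearMap.mk₂_apply, map_neg]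
  generalize δ x = t
  congr 1
  induction t using TensorProduct.induction_on with
  | zero => simp
  | add a c ha hc => simp only [map_add, ha, hc]
  | tmul a c => simp

def auxB (b : V →ₗ[K] V →ₗ[K] V) (δ : V →ₗ[K] V ⊗[K] V) :
    (V × Module.Dual K V) →ₗ[K] (V × Module.Dual K V) →ₗ[K] (V × Module.Dual K V) :=
  LinearMap.mk₂ K (fun u v => (b u.1 v.1 + auxC δ u.2 v.1 - auxC δ v.2 u.1,
      dualBracketL δ u.2 v.2 - v.2 ∘ₗ b u.1 + u.2 ∘ₗ b v.1))
    (by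
      intro u u' v
      ext <;> simp [LinearMap.comp_add, LinearMap.add_comp] <;> abel)
    (by
      intro k u v
      ext <;> simp [LinearMap.comp_smul, smul_sub, smul_add])
    (by
      intro u u' v
      ext <;> simp [LinearMap.comp_add, LinearMap.add_comp] <;> abel)
    (by
      intro k u v
      ext <;> simp [LinearMap.comp_smul, smul_sub, smul_add])

theorem auxB_apply (b : V →ₗ[K] V →ₗ[K] V) (δ : V →ₗ[K] V ⊗[K] V) (x y : V)
    (ξ η : Module.Dual K V) : auxB b δ (x, ξ) (y, η) =
      (b x y + auxC δ ξ y - auxC δ η x,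
      dualBracketL δ ξ η - η ∘ₗ b x + ξ ∘ₗ b y) := rfl

theorem aux_ext {x y : V} (h : ∀ ζ : Module.Dual K V, ζ x = ζ y) : x = y :=
  (Module.forall_dual_apply_eq_zero_iff K (x - y)).1 (fun f => by rw [map_sub, h, sub_self])
    |> sub_eq_zero.1

theorem aux_b_anti (b : V →ₗ[K] V →ₗ[K] V) (hb : IsLieBracket b) (x y : V) :
    b x y = - b y x := by
  have := hb.1 (x + y)
  simp only [map_add, LinearMap.add_apply, hb.1, zero_add, add_zero] at this
  exact eq_neg_of_add_eq_zero_right this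

theorem aux_bC (b : V →ₗ[K] V →ₗ[K] V) (hb : IsLieBracket b) (δ : V →ₗ[K] V ⊗[K] V)
    (ξ ζ : Module.Dual K V) (y z : V) :
    ζ (b (auxC δ ξ y) z) = dualBracketL δ ξ (ζ ∘ₗ b z) y := by
  rw [aux_b_anti b hb, map_neg]
  have := auxC_apply δ ξ (ζ ∘ₗ b z) y
  rw [LinearMap.comp_apply] at this
  rw [this, neg_neg]

theorem aux_bC2 (b : V →ₗ[K] V →ₗ[K] V) (δ : V →ₗ[K] V ⊗[K] V)
    (ξ ζ : Module.Dual K V) (y z : V) :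
    ζ (b z (auxC δ ξ y)) = - dualBracketL δ ξ (ζ ∘ₗ b z) y :=
  auxC_apply δ ξ (ζ ∘ₗ b z) y

end helpers

/-- A finite-dimensional Lie bialgebra `(V, b, δ)` over a field of
characteristic zero gives rise to a Lie bracket `B` on `g = V × V*` restricting to `b` on
`V × {0}` and to the dual bracket of `δ` on `{0} × V*`, for which the canonical symmetric
form is invariant.  In particular `(V ⊕ V*, V, V*)` is a Manin triple: `V × {0}` and
`{0} × V*` are Lie subalgebras of `(g, B)`, each isotropic for the canonical form. -/
theorem statement1 {K : Type*} [Field K] [CharZero K] {V : Type*} [AddCommGroup V]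
    [Module K V] [FiniteDimensional K V]
    (b : V →ₗ[K] V →ₗ[K] V) (δ : V →ₗ[K] V ⊗[K] V)
    (hb : IsLieBracket b) (hanti : CoAnti δ) (hcojac : CoJacobi δ) (hcoc : Cocycle b δ) :
    ∃ B : (V × Module.Dual K V) →ₗ[K] (V × Module.Dual K V) →ₗ[K] (V × Module.Dual K V),
      (∀ u, B u u = 0) ∧
      (∀ u v w, B (B u v) w + B (B v w) u + B (B w u) v = 0) ∧
      (∀ x y : V, B (x, 0) (y, 0) = (b x y, 0)) ∧
      (∀ ξ η : Module.Dual K V, B (0, ξ) (0, η) = (0, dualBracketL δ ξ η)) ∧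
      (∀ u v w, canForm (B u v) w = - canForm v (B u w)) ∧
      (∀ u ∈ Submodule.fst K V (Module.Dual K V), ∀ v ∈ Submodule.fst K V (Module.Dual K V),
        B u v ∈ Submodule.fst K V (Module.Dual K V)) ∧
      (∀ u ∈ Submodule.snd K V (Module.Dual K V), ∀ v ∈ Submodule.snd K V (Module.Dual K V),
        B u v ∈ Submodule.snd K V (Module.Dual K V)) ∧
      (∀ u ∈ Submodule.fst K V (Module.Dual K V), ∀ v ∈ Submodule.fst K V (Module.Dual K V),
        canForm u v = 0) ∧
      (∀ u ∈ Submodule.snd K V (Module.Dual K V), ∀ v ∈ Submodule.snd K V (Module.Dual K V),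
        canForm u v = 0) := by
  have h2 : (2 : K) ≠ 0 := two_ne_zero
  have A := aux_beta_anti δ hanti
  have J := aux_beta_jac δ hcojac
  have C := aux_beta_cocycle b δ hcoc
  have bA := aux_b_anti b hb
  have L : ∀ (ξ η ζ : Module.Dual K V) (v : V),
      dualBracketL δ (dualBracketL δ ξ η) ζ v =
        dualBracketL δ ξ (dualBracketL δ η ζ) v - dualBracketL δ η (dualBracketL δ ξ ζ) v := by
    intro ξ η ζ v
    have e : dualBracketL δ ζ ξ = - dualBracketL δ ξ ζ := by
      ext w
      rw [A]; rfl
    have h1 := J ξ η ζ v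
    rw [e, map_neg, LinearMap.neg_apply, LinearMap.neg_apply] at h1
    linear_combination h1 - A (dualBracketL δ η ζ) ξ v + A (dualBracketL δ ξ ζ) η v
  have Lb : ∀ (ζ : Module.Dual K V) (x y z : V),
      ζ (b (b x y) z) = ζ (b x (b y z)) - ζ (b y (b x z)) := by
    intro ζ x y z
    have h1 := congrArg ζ (hb.2 x y z)
    rw [bA (b y z) x, bA (b z x) y, bA z x] at h1
    simp only [map_add, map_neg, map_zero, neg_neg] at h1
    linear_combination h1
  have inv : ∀ u v w, canForm (auxB b δ u v) w = - canForm v (auxB b δ u w) := by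
    rintro ⟨x, ξ⟩ ⟨y, η⟩ ⟨z, ζ⟩
    simp only [auxB_apply, canForm, LinearMap.add_apply, LinearMap.sub_apply,
      LinearMap.comp_apply, map_add, map_sub, auxC_apply]
    have e : ξ (b y z) = - ξ (b z y) := by rw [bA, map_neg]
    linear_combination e + A η ζ x
  refine ⟨auxB b δ, ?_, ?_, ?_, ?_, inv, ?_, ?_, ?_, ?_⟩
  · rintro ⟨x, ξ⟩
    rw [auxB_apply]
    ext v
    · simp [hb.1]
    · have : dualBracketL δ ξ ξ v = 0 := by
        have := A ξ ξ v
        have h3 : 2 * dualBracketL δ ξ ξ v = 0 := by linear_combination this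
        simpa [h2] using h3
      simp [this]
  · rintro ⟨x, ξ⟩ ⟨y, η⟩ ⟨z, θ⟩
    simp only [auxB_apply]
    refine Prod.ext ?_ ?_
    · refine aux_ext (K := K) fun ζ => ?_
      have j := congrArg ζ (hb.2 x y z)
      simp only [map_add, map_zero] at j
      simp only [Prod.fst_add, Prod.fst_zero, map_add, map_sub, LinearMap.add_apply,
        LinearMap.sub_apply, auxC_apply, aux_bC b hb, aux_bC2, map_zero, C]
      linear_combination j - L η θ ζ x - L θ ξ ζ y - L ξ η ζ z
    · ext t
      simp only [Prod.snd_add, Prod.snd_zero, map_add, map_sub, LinearMap.add_apply,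
        LinearMap.sub_apply, auxC_apply, aux_bC b hb, aux_bC2, map_zero, LinearMap.zero_apply, LinearMap.comp_apply, C]
      linear_combination J ξ η θ t - Lb θ x y t - Lb ξ y z t - Lb η z x t
        + A (ξ ∘ₗ b y) θ t + A (η ∘ₗ b z) ξ t + A (θ ∘ₗ b x) η t
        - A (η ∘ₗ b t) θ x - A (θ ∘ₗ b t) ξ y - A (ξ ∘ₗ b t) η z
  · intro x y
    rw [auxB_apply]; simp
  · intro x y
    rw [auxB_apply]; simp
  · rintro ⟨x, ξ⟩ hu ⟨y, η⟩ hv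
    simp only [Submodule.fst, Submodule.mem_comap, LinearMap.snd_apply, Submodule.mem_bot] at hu hv ⊢
    subst hu hv
    simp [auxB_apply]
  · rintro ⟨x, ξ⟩ hu ⟨y, η⟩ hv
    simp only [Submodule.snd, Submodule.mem_comap, LinearMap.fst_apply, Submodule.mem_bot] at hu hv ⊢
    subst hu hv
    simp [auxB_apply]
  · rintro ⟨x, ξ⟩ hu ⟨y, η⟩ hv
    simp only [Submodule.fst, Submodule.mem_comap, LinearMap.snd_apply, Submodule.mem_bot] at hu hv
    subst hu hv
    simp [canForm]
  · rintro ⟨x, ξ⟩ hu ⟨y, η⟩ hv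
    simp only [Submodule.snd, Submodule.mem_comap, LinearMap.fst_apply, Submodule.mem_bot] at hu hv
    subst hu hv
    simp [canForm]
end
end

section
/- Let K be a field of characteristic zero, V a finite-dimensional K-vector space, and let B be a bilinear, alternating bracket on g = V × V* satisfying the Jacobi identity, such that V × {0} and {0} × V* are Lie subalgebras of (g, B) and the canonical symmetric form ⟨(x,ξ),(y,η)⟩ = ξ(y) + η(x) is invariant for B. Define b(x,y) to be the V-component of B((x,0),(y,0)), and let δ : V → V ⊗ V be the unique linear map such that (ξ ⊗ η)(δ v) = ⟨B((0,ξ),(0,η)), (v,0)⟩ for all ξ, η ∈ V* and v ∈ V. Then (V, b, δ) is a Lie bialgebra: b is an alternating bracket satisfying the Jacobi identity, δ satisfies τ ∘ δ = −δ and the co-Jacobi identity, and δ satisfies the 1-cocycle condition with respect to b. -/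
open TensorProduct

noncomputable section

variable (K : Type*) [Field K] (M : Type*) [AddCommGroup M] [Module K M]

variable {K M}

/-- The bracket on `M` extracted from a bracket `B` on `M × M*`:
`bOf B x y` is the `M`-component of `B (x, 0) (y, 0)`. -/
def bOf (B : (M × Module.Dual K M) →ₗ[K] (M × Module.Dual K M) →ₗ[K]
    (M × Module.Dual K M)) : M →ₗ[K] M →ₗ[K] M :=
  (B.compl₁₂ (LinearMap.inl K M (Module.Dual K M))
    (LinearMap.inl K M (Module.Dual K M))).compr₂ (LinearMap.fst K M (Module.Dual K M))

theorem dd_ext {K V W : Type*} [Field K] [AddCommGroup V] [Module K V] [FiniteDimensional K V]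
    [AddCommGroup W] [Module K W] [FiniteDimensional K W] (t s : V ⊗[K] W)
    (h : ∀ (ξ : Module.Dual K V) (η : Module.Dual K W),
      TensorProduct.dualDistrib K V W (ξ ⊗ₜ η) t = TensorProduct.dualDistrib K V W (ξ ⊗ₜ η) s) :
    t = s := by
  rw [← sub_eq_zero, ← Module.forall_dual_apply_eq_zero_iff K]
  intro φ
  obtain ⟨z, rfl⟩ := (TensorProduct.dualDistribEquiv K V W).surjective φ
  change TensorProduct.dualDistrib K V W z (t - s) = 0
  induction z with
  | zero => simp
  | tmul ξ η => rw [map_sub, h, sub_self]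
  | add a b ha hb => rw [map_add, LinearMap.add_apply, ha, hb, add_zero]

theorem dd_ext3 {K V : Type*} [Field K] [AddCommGroup V] [Module K V] [FiniteDimensional K V]
    (t : V ⊗[K] (V ⊗[K] V))
    (h : ∀ (ξ η ζ : Module.Dual K V),
      TensorProduct.dualDistrib K V (V ⊗[K] V)
        (ξ ⊗ₜ (TensorProduct.dualDistrib K V V (η ⊗ₜ ζ))) t = 0) :
    t = 0 := by
  apply dd_ext
  intro ξ φ
  rw [map_zero]
  obtain ⟨z, rfl⟩ := (TensorProduct.dualDistribEquiv K V V).surjective φ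
  change TensorProduct.dualDistrib K V (V ⊗[K] V)
    (ξ ⊗ₜ (TensorProduct.dualDistrib K V V z)) t = 0
  induction z with
  | zero => simp
  | tmul η ζ => exact h ξ η ζ
  | add a b ha hb =>
    rw [map_add, TensorProduct.tmul_add, map_add, LinearMap.add_apply, ha, hb, add_zero]

theorem dd_sigma {K V : Type*} [Field K] [AddCommGroup V] [Module K V]
    (ξ η ζ : Module.Dual K V) (t : V ⊗[K] (V ⊗[K] V)) :
    TensorProduct.dualDistrib K V (V ⊗[K] V)
        (ξ ⊗ₜ (TensorProduct.dualDistrib K V V (η ⊗ₜ ζ))) (sigmaMap K V t) =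
    TensorProduct.dualDistrib K V (V ⊗[K] V)
        (ζ ⊗ₜ (TensorProduct.dualDistrib K V V (ξ ⊗ₜ η))) t := by
  induction t with
  | zero => simp
  | add a b ha hb => simp only [map_add, ha, hb]
  | tmul a r =>
    induction r with
    | zero => simp
    | add a b ha hb => simp only [map_add, TensorProduct.tmul_add, ha, hb]
    | tmul b c => simp [sigmaMap]; ring

theorem dd_assoc {K V : Type*} [Field K] [AddCommGroup V] [Module K V]
    (ξ η ζ : Module.Dual K V) (r : V ⊗[K] V) (c : V) :
    TensorProduct.dualDistrib K V (V ⊗[K] V)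
        (ξ ⊗ₜ (TensorProduct.dualDistrib K V V (η ⊗ₜ ζ)))
          (TensorProduct.assoc K V V V (r ⊗ₜ c)) =
    TensorProduct.dualDistrib K V V (ξ ⊗ₜ η) r * ζ c := by
  induction r with
  | zero => simp
  | add a b ha hb => simp only [map_add, TensorProduct.add_tmul, ha, hb, add_mul]
  | tmul a b => simp; ring

theorem dd_deltaExt {K V : Type*} [Field K] [AddCommGroup V] [Module K V]
    (δ : V →ₗ[K] V ⊗[K] V) (ξ η ζ : Module.Dual K V) (t : V ⊗[K] V) :
    TensorProduct.dualDistrib K V (V ⊗[K] V)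
        (ξ ⊗ₜ (TensorProduct.dualDistrib K V V (η ⊗ₜ ζ))) (deltaExt δ t) =
    TensorProduct.dualDistrib K V V (dualBracketL δ ξ η ⊗ₜ ζ) t := by
  induction t with
  | zero => simp
  | add a b ha hb => simp only [map_add, ha, hb]
  | tmul a c =>
    have := dd_assoc ξ η ζ (δ a) c
    simpa [deltaExt, dualBracketL] using this

theorem dd_tau {K V : Type*} [Field K] [AddCommGroup V] [Module K V]
    (ξ η : Module.Dual K V) (t : V ⊗[K] V) :
    TensorProduct.dualDistrib K V V (ξ ⊗ₜ η) (tauMap K V t) =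
    TensorProduct.dualDistrib K V V (η ⊗ₜ ξ) t := by
  induction t with
  | zero => simp
  | add a b ha hb => simp only [map_add, ha, hb]
  | tmul a b => simp [tauMap]; ring

theorem dd_adT {K V : Type*} [Field K] [AddCommGroup V] [Module K V]
    (b : V →ₗ[K] V →ₗ[K] V) (x : V) (ξ η : Module.Dual K V) (t : V ⊗[K] V) :
    TensorProduct.dualDistrib K V V (ξ ⊗ₜ η) (adT b x t) =
    TensorProduct.dualDistrib K V V ((ξ ∘ₗ b x) ⊗ₜ η) t +
    TensorProduct.dualDistrib K V V (ξ ⊗ₜ (η ∘ₗ b x)) t := by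
  induction t with
  | zero => simp
  | add a b ha hb => simp only [map_add, ha, hb]; ring
  | tmul a b => simp [adT]

theorem dbl_apply {K V : Type*} [Field K] [AddCommGroup V] [Module K V]
    (δ : V →ₗ[K] V ⊗[K] V) (ξ η : Module.Dual K V) (v : V) :
    TensorProduct.dualDistrib K V V (ξ ⊗ₜ η) (δ v) = dualBracketL δ ξ η v := rfl

theorem exists_delta {K V : Type*} [Field K] [AddCommGroup V] [Module K V]
    [FiniteDimensional K V]
    (D : Module.Dual K V →ₗ[K] Module.Dual K V →ₗ[K] Module.Dual K V) :
    ∃ δ : V →ₗ[K] V ⊗[K] V, ∀ ξ η v, dualBracketL δ ξ η v = D ξ η v := by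
  let T : Module.Dual K V ⊗[K] Module.Dual K V →ₗ[K] Module.Dual K V := TensorProduct.lift D
  let e := TensorProduct.dualDistribEquiv K V V
  let S : Module.Dual K (V ⊗[K] V) →ₗ[K] Module.Dual K V := T ∘ₗ e.symm.toLinearMap
  refine ⟨(Module.evalEquiv K (V ⊗[K] V)).symm.toLinearMap ∘ₗ S.flip, fun ξ η v => ?_⟩
  rw [← dbl_apply]
  have he : TensorProduct.dualDistrib K V V (ξ ⊗ₜ η) = e (ξ ⊗ₜ η) := rfl
  rw [he]
  simp [S, T]

/-- If `B` is an alternating bracket on `g = V × V*` satisfying the Jacobi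
identity, for which `V × {0}` and `{0} × V*` are subalgebras and the canonical symmetric
form is invariant, then `b (x, y) := (B (x,0) (y,0)).1` and the unique linear map
`δ : V → V ⊗ V` with `(ξ ⊗ η)(δ v) = ⟨B (0,ξ) (0,η), (v,0)⟩` constitute a Lie bialgebra
structure on `V`. -/
theorem statement2 {K : Type*} [Field K] [CharZero K] {V : Type*} [AddCommGroup V]
    [Module K V] [FiniteDimensional K V]
    (B : (V × Module.Dual K V) →ₗ[K] (V × Module.Dual K V) →ₗ[K] (V × Module.Dual K V))
    (halt : ∀ u, B u u = 0)
    (hjac : ∀ u v w, B (B u v) w + B (B v w) u + B (B w u) v = 0)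
    (hV : ∀ u ∈ Submodule.fst K V (Module.Dual K V), ∀ v ∈ Submodule.fst K V (Module.Dual K V),
      B u v ∈ Submodule.fst K V (Module.Dual K V))
    (hVd : ∀ u ∈ Submodule.snd K V (Module.Dual K V), ∀ v ∈ Submodule.snd K V (Module.Dual K V),
      B u v ∈ Submodule.snd K V (Module.Dual K V))
    (hinv : ∀ u v w, canForm (B u v) w = - canForm v (B u w)) :
    IsLieBracket (bOf B) ∧
    (∃! δ : V →ₗ[K] V ⊗[K] V, ∀ (ξ η : Module.Dual K V) (v : V),
      dualBracketL δ ξ η v = canForm (B (0, ξ) (0, η)) (v, 0)) ∧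
    (∀ δ : V →ₗ[K] V ⊗[K] V,
      (∀ (ξ η : Module.Dual K V) (v : V),
        dualBracketL δ ξ η v = canForm (B (0, ξ) (0, η)) (v, 0)) →
      CoAnti δ ∧ CoJacobi δ ∧ Cocycle (bOf B) δ) := by
  have hanti : ∀ u v, B u v = - B v u := by
    intro u v
    have h := halt (u + v)
    simp only [map_add, LinearMap.add_apply, halt, zero_add, add_zero] at h
    exact eq_neg_of_add_eq_zero_right h
  have h1 : ∀ x y : V, B (x, 0) (y, 0) = (bOf B x y, 0) := by
    intro x y
    have h := hV (x, 0) (by simp [Submodule.fst]) (y, 0) (by simp [Submodule.fst])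
    refine Prod.ext rfl ?_
    simpa [Submodule.fst] using h
  have h2 : ∀ ξ η : Module.Dual K V, (B (0, ξ) (0, η)).1 = 0 := by
    intro ξ η
    have h := hVd (0, ξ) (by simp [Submodule.snd]) (0, η) (by simp [Submodule.snd])
    simpa [Submodule.snd] using h
  have hb0 : ∀ x, bOf B x x = 0 := fun x => congrArg Prod.fst (halt (x, 0))
  refine ⟨⟨hb0, ?_⟩, ?_, ?_⟩
  · intro x y z
    have h := hjac (x, 0) (y, 0) (z, 0)
    simp only [h1] at h
    exact congrArg Prod.fst h
  · let D : Module.Dual K V →ₗ[K] Module.Dual K V →ₗ[K] Module.Dual K V :=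
      (B.compl₁₂ (LinearMap.inr K V (Module.Dual K V))
        (LinearMap.inr K V (Module.Dual K V))).compr₂ (LinearMap.snd K V (Module.Dual K V))
    obtain ⟨δ, hδ⟩ := exists_delta D
    have hδ' : ∀ (ξ η : Module.Dual K V) (v : V),
        dualBracketL δ ξ η v = canForm (B (0, ξ) (0, η)) (v, 0) := by
      intro ξ η v
      rw [hδ]
      simp [canForm, D]
    refine ⟨δ, hδ', ?_⟩
    intro δ' h'
    refine LinearMap.ext fun v => dd_ext _ _ fun ξ η => ?_
    rw [dbl_apply, dbl_apply, h', hδ']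
  · intro δ hδ
    have h3 : ∀ ξ η : Module.Dual K V, B (0, ξ) (0, η) = (0, dualBracketL δ ξ η) := by
      intro ξ η
      refine Prod.ext (h2 ξ η) (LinearMap.ext fun v => ?_)
      change _ = dualBracketL δ ξ η v
      rw [hδ]
      simp [canForm]
    have hDanti : ∀ (ξ η : Module.Dual K V), dualBracketL δ ξ η = - dualBracketL δ η ξ := by
      intro ξ η
      have h := hanti (0, ξ) (0, η)
      rw [h3, h3] at h
      exact congrArg Prod.snd h
    have h4 : ∀ (ξ : Module.Dual K V) (x : V), (B (0, ξ) (x, 0)).2 = ξ ∘ₗ bOf B x := by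
      intro ξ x
      refine LinearMap.ext fun y => ?_
      have h := hinv (x, 0) (0, ξ) (y, 0)
      rw [hanti, h1] at h
      simpa [canForm] using h
    have h5 : ∀ (ξ ζ : Module.Dual K V) (x : V),
        ζ (B (0, ξ) (x, 0)).1 = - dualBracketL δ ξ ζ x := by
      intro ξ ζ x
      have h := hinv (0, ξ) (x, 0) (0, ζ)
      rw [h3] at h
      simpa [canForm] using h
    refine ⟨?_, ?_, ?_⟩
    · refine LinearMap.ext fun v => dd_ext _ _ fun ξ η => ?_
      rw [LinearMap.comp_apply, dd_tau, LinearMap.neg_apply, map_neg, dbl_apply, dbl_apply, hDanti]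
      rfl
    · refine LinearMap.ext fun v => dd_ext3 _ fun ξ η ζ => ?_
      simp only [LinearMap.comp_apply, LinearMap.add_apply, LinearMap.id_apply, map_add,
        dd_sigma, dd_deltaExt, dbl_apply]
      have h := hjac (0, ξ) (0, η) (0, ζ)
      simp only [h3] at h
      have h' := LinearMap.congr_fun (congrArg Prod.snd h) v
      simp only [Prod.snd_add, LinearMap.add_apply, Prod.snd_zero, LinearMap.zero_apply] at h'
      linear_combination h'
    · intro x y
      refine dd_ext _ _ fun ξ η => ?_
      rw [map_sub, dd_adT, dd_adT]
      simp only [dbl_apply]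
      have hJ := hjac (x, 0) (y, 0) (0, ξ)
      have hJ' := congrArg (fun u => canForm u (0, η)) hJ
      rw [h1, hanti (bOf B x y, 0), hanti (B (y, 0) (0, ξ)), hanti (y, 0) (0, ξ),
        hanti (B (0, ξ) (x, 0)) (y, 0), map_neg, neg_neg] at hJ'
      have e2 := hinv (x, 0) (B (0, ξ) (y, 0)) (0, η)
      have e3 := hinv (y, 0) (B (0, ξ) (x, 0)) (0, η)
      rw [hanti (x, 0) (0, η)] at e2
      rw [hanti (y, 0) (0, η)] at e3
      simp only [canForm, Prod.fst_add, Prod.snd_add, Prod.fst_neg, Prod.snd_neg, Prod.fst_zero,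
        Prod.snd_zero, map_add, map_neg, LinearMap.neg_apply, LinearMap.zero_apply, map_zero,
        zero_add, add_zero, h4, h5] at hJ' e2 e3
      have a1 := LinearMap.congr_fun (hDanti η (ξ ∘ₗ bOf B y)) x
      have a2 := LinearMap.congr_fun (hDanti η (ξ ∘ₗ bOf B x)) y
      simp only [LinearMap.neg_apply] at a1 a2
      linear_combination hJ' - e2 + e3 + a1 - a2
end
end

section
/- Let L be a Lie algebra over a commutative ring R and let D : L → L be a linear derivation of the bracket with D ∘ D = 0. Then the derived bracket {a, b} := ⁅D a, b⁆ satisfies the (left) Leibniz–Loday identity: for all a, b, c ∈ L, ⁅D a, ⁅D b, c⁆⁆ = ⁅D(⁅D a, b⁆), c⁆ + ⁅D b, ⁅D a, c⁆⁆. -/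
/-- If `D` is a square-zero linear derivation of a Lie algebra `L` over a
commutative ring `R`, then the derived bracket `{a, b} := ⁅D a, b⁆` satisfies the (left)
Leibniz–Loday identity. -/
theorem statement6 {R : Type*} {L : Type*} [CommRing R] [LieRing L] [LieAlgebra R L]
    (D : L →ₗ[R] L) (hder : ∀ a b : L, D ⁅a, b⁆ = ⁅D a, b⁆ + ⁅a, D b⁆)
    (hsq : ∀ a : L, D (D a) = 0) :
    ∀ a b c : L, ⁅D a, ⁅D b, c⁆⁆ = ⁅D ⁅D a, b⁆, c⁆ + ⁅D b, ⁅D a, c⁆⁆ := by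
  intro a b c
  rw [hder, hsq, zero_lie, zero_add]
  exact leibniz_lie (D a) (D b) c
end

section
/- Let L be a Lie algebra over a commutative ring R, let D : L → L be a linear derivation of the bracket with D ∘ D = 0, and let W ⊆ L be an R-submodule that is abelian (⁅a, b⁆ = 0 for all a, b ∈ W) and closed under the derived bracket (⁅D a, b⁆ ∈ W for all a, b ∈ W). Then the derived bracket restricted to W is a symmetric bilinear operation, ⁅D a, b⁆ = ⁅D b, a⁆ for all a, b ∈ W, which satisfies the Leibniz-type Jacobi identity ⁅D a, ⁅D b, c⁆⁆ = ⁅D(⁅D a, b⁆), c⁆ + ⁅D b, ⁅D a, c⁆⁆ for all a, b, c ∈ W. -/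
/-- Let `D` be a square-zero linear derivation of a Lie algebra `L` over a
commutative ring `R`, and let `W ⊆ L` be a submodule that is abelian and closed under the
derived bracket `(a, b) ↦ ⁅D a, b⁆`.  Then the derived bracket restricted to `W` is
symmetric and satisfies the Leibniz-type Jacobi identity. -/
theorem statement8 {R : Type*} {L : Type*} [CommRing R] [LieRing L] [LieAlgebra R L]
    (D : L →ₗ[R] L) (hder : ∀ a b : L, D ⁅a, b⁆ = ⁅D a, b⁆ + ⁅a, D b⁆)
    (hsq : ∀ a : L, D (D a) = 0) (W : Submodule R L)
    (habel : ∀ a ∈ W, ∀ b ∈ W, ⁅a, b⁆ = (0 : L))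
    (hclosed : ∀ a ∈ W, ∀ b ∈ W, ⁅D a, b⁆ ∈ W) :
    (∀ a ∈ W, ∀ b ∈ W, ⁅D a, b⁆ = ⁅D b, a⁆) ∧
    (∀ a ∈ W, ∀ b ∈ W, ∀ c ∈ W,
      ⁅D a, ⁅D b, c⁆⁆ = ⁅D ⁅D a, b⁆, c⁆ + ⁅D b, ⁅D a, c⁆⁆) := by
  refine ⟨fun a ha b hb => ?_, fun a _ b _ c _ => ?_⟩
  · have h := hder a b
    rw [habel a ha b hb, map_zero, ← lie_skew a (D b)] at h
    rw [← sub_eq_add_neg] at h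
    exact sub_eq_zero.mp h.symm
  · rw [hder, hsq, zero_lie, zero_add]
    exact leibniz_lie _ _ _
end

section
/- Let (V, b, δ, φ) be a finite-dimensional Lie quasi-bialgebra over a field K of characteristic zero. Then there exists a bilinear, alternating bracket B on g = V × V* satisfying the Jacobi identity such that: (i) B((x,0),(y,0)) = (b(x,y), 0) for all x, y ∈ V; (ii) for all ξ, η ∈ V*, the V*-component of B((0,ξ),(0,η)) is the functional v ↦ (ξ ⊗ η)(δ v); and (iii) the canonical symmetric form ⟨(x,ξ),(y,η)⟩ = ξ(y) + η(x) is invariant for B. In particular (g, V × {0}) is a Manin pair: V × {0} is a Lie subalgebra of (g, B) that is isotropic for the canonical form. -/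
open TensorProduct

noncomputable section

variable (K : Type*) [Field K] (M : Type*) [AddCommGroup M] [Module K M]

variable {K M}

variable (K M) in
/-- Transposition of the first two tensor factors: `a ⊗ b ⊗ c ↦ b ⊗ a ⊗ c`. -/
def swap12 : M ⊗[K] (M ⊗[K] M) →ₗ[K] M ⊗[K] (M ⊗[K] M) :=
  (TensorProduct.assoc K M M M).toLinearMap ∘ₗ
    LinearMap.rTensor M (TensorProduct.comm K M M).toLinearMap ∘ₗ
      (TensorProduct.assoc K M M M).symm.toLinearMap

variable (K M) in
/-- Transposition of the last two tensor factors: `a ⊗ b ⊗ c ↦ a ⊗ c ⊗ b`. -/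
def swap23 : M ⊗[K] (M ⊗[K] M) →ₗ[K] M ⊗[K] (M ⊗[K] M) :=
  LinearMap.lTensor M (TensorProduct.comm K M M).toLinearMap

/-- The adjoint action of `x` on `M ⊗ M ⊗ M`, acting by the bracket `b` on each factor. -/
def adT3 (b : M →ₗ[K] M →ₗ[K] M) (x : M) :
    M ⊗[K] (M ⊗[K] M) →ₗ[K] M ⊗[K] (M ⊗[K] M) :=
  LinearMap.rTensor (M ⊗[K] M) (b x) + LinearMap.lTensor M (LinearMap.rTensor M (b x)) +
    LinearMap.lTensor M (LinearMap.lTensor M (b x))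

/-- The map `δ ⊗ id ⊗ id + id ⊗ δ ⊗ id + id ⊗ id ⊗ δ` from the threefold to the fourfold
tensor power. -/
def delta4 (δ : M →ₗ[K] M ⊗[K] M) :
    M ⊗[K] (M ⊗[K] M) →ₗ[K] M ⊗[K] (M ⊗[K] (M ⊗[K] M)) :=
  (TensorProduct.assoc K M M (M ⊗[K] M)).toLinearMap ∘ₗ LinearMap.rTensor (M ⊗[K] M) δ +
    LinearMap.lTensor M (deltaExt δ) + LinearMap.lTensor M (LinearMap.lTensor M δ)

namespace QB

def ev2 (ξ η : Module.Dual K M) : M ⊗[K] M →ₗ[K] K :=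
  TensorProduct.lift ((LinearMap.mul K K).compl₁₂ ξ η)

def ev3 (ξ η ζ : Module.Dual K M) : M ⊗[K] (M ⊗[K] M) →ₗ[K] K :=
  TensorProduct.lift ((LinearMap.mul K K).compl₁₂ ξ (ev2 η ζ))

def ev4 (ξ η ζ θ : Module.Dual K M) : M ⊗[K] (M ⊗[K] (M ⊗[K] M)) →ₗ[K] K :=
  TensorProduct.lift ((LinearMap.mul K K).compl₁₂ ξ (ev3 η ζ θ))

@[simp] lemma ev2_tmul (ξ η : Module.Dual K M) (a c : M) :
    ev2 ξ η (a ⊗ₜ[K] c) = ξ a * η c := rfl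
@[simp] lemma ev3_tmul (ξ η ζ : Module.Dual K M) (a : M) (c : M ⊗[K] M) :
    ev3 ξ η ζ (a ⊗ₜ[K] c) = ξ a * ev2 η ζ c := rfl
@[simp] lemma ev4_tmul (ξ η ζ θ : Module.Dual K M) (a : M) (c : M ⊗[K] (M ⊗[K] M)) :
    ev4 ξ η ζ θ (a ⊗ₜ[K] c) = ξ a * ev3 η ζ θ c := rfl

lemma D_apply (δ : M →ₗ[K] M ⊗[K] M) (ξ η : Module.Dual K M) (x : M) :
    dualBracketL δ ξ η x = ev2 ξ η (δ x) := by
  have : ∀ t : M ⊗[K] M, TensorProduct.dualDistrib K M M (ξ ⊗ₜ η) t = ev2 ξ η t := by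
    intro t
    induction t with
    | zero => simp
    | tmul a c => simp
    | add a c h1 h2 => simp only [map_add, h1, h2]
  simpa [dualBracketL] using this (δ x)

lemma ev3_assoc (ξ η ζ : Module.Dual K M) (s : M ⊗[K] M) (c : M) :
    ev3 ξ η ζ (TensorProduct.assoc K M M M (s ⊗ₜ c)) = ev2 ξ η s * ζ c := by
  induction s with
  | zero => simp
  | tmul a c => simp [mul_assoc]
  | add a c h1 h2 => simp only [TensorProduct.add_tmul, map_add, h1, h2, add_mul]

lemma ev4_assoc (ξ η ζ θ : Module.Dual K M) (s : M ⊗[K] M) (c : M ⊗[K] M) :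
    ev4 ξ η ζ θ (TensorProduct.assoc K M M (M ⊗[K] M) (s ⊗ₜ c)) = ev2 ξ η s * ev2 ζ θ c := by
  induction s with
  | zero => simp
  | tmul a c => simp [mul_assoc]
  | add a c h1 h2 => simp only [TensorProduct.add_tmul, map_add, h1, h2, add_mul]

lemma ev2_tau (ξ η : Module.Dual K M) (t : M ⊗[K] M) :
    ev2 ξ η (TensorProduct.comm K M M t) = ev2 η ξ t := by
  induction t with
  | zero => simp
  | tmul a c => simp [mul_comm]
  | add a c h1 h2 => simp only [map_add, h1, h2]

lemma ev2_adT (b : M →ₗ[K] M →ₗ[K] M) (x : M) (ξ η : Module.Dual K M) (t : M ⊗[K] M) :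
    ev2 ξ η (adT b x t) = ev2 (ξ ∘ₗ b x) η t + ev2 ξ (η ∘ₗ b x) t := by
  induction t with
  | zero => simp
  | tmul a c => simp [adT]
  | add a c h1 h2 => simp only [map_add, h1, h2]; ring

lemma ev3_ext {f g : M ⊗[K] (M ⊗[K] M) →ₗ[K] K}
    (h : ∀ a c d, f (a ⊗ₜ (c ⊗ₜ d)) = g (a ⊗ₜ (c ⊗ₜ d))) : f = g := by
  ext a c d
  exact h a c d

lemma ev3_swap12 (ξ η ζ : Module.Dual K M) (t : M ⊗[K] (M ⊗[K] M)) :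
    ev3 ξ η ζ (swap12 K M t) = ev3 η ξ ζ t := by
  have : ev3 ξ η ζ ∘ₗ swap12 K M = ev3 η ξ ζ := ev3_ext fun a c d => by
    simp [swap12]; ring
  exact LinearMap.congr_fun this t

lemma ev3_swap23 (ξ η ζ : Module.Dual K M) (t : M ⊗[K] (M ⊗[K] M)) :
    ev3 ξ η ζ (swap23 K M t) = ev3 ξ ζ η t := by
  have : ev3 ξ η ζ ∘ₗ swap23 K M = ev3 ξ ζ η := ev3_ext fun a c d => by
    simp [swap23, mul_comm]
  exact LinearMap.congr_fun this t

lemma ev3_sigma (ξ η ζ : Module.Dual K M) (t : M ⊗[K] (M ⊗[K] M)) :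
    ev3 ξ η ζ (sigmaMap K M t) = ev3 ζ ξ η t := by
  have : ev3 ξ η ζ ∘ₗ sigmaMap K M = ev3 ζ ξ η := ev3_ext fun a c d => by
    simp [sigmaMap]; ring
  exact LinearMap.congr_fun this t

lemma ev3_adT3 (b : M →ₗ[K] M →ₗ[K] M) (x : M) (ξ η ζ : Module.Dual K M)
    (t : M ⊗[K] (M ⊗[K] M)) :
    ev3 ξ η ζ (adT3 b x t) = ev3 (ξ ∘ₗ b x) η ζ t + ev3 ξ (η ∘ₗ b x) ζ t
      + ev3 ξ η (ζ ∘ₗ b x) t := by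
  have : ev3 ξ η ζ ∘ₗ adT3 b x = ev3 (ξ ∘ₗ b x) η ζ + ev3 ξ (η ∘ₗ b x) ζ
      + ev3 ξ η (ζ ∘ₗ b x) := ev3_ext fun a c d => by
    simp [adT3]
  exact LinearMap.congr_fun this t

lemma ev3_deltaExt (δ : M →ₗ[K] M ⊗[K] M) (ξ η ζ : Module.Dual K M) (t : M ⊗[K] M) :
    ev3 ξ η ζ (deltaExt δ t) = ev2 (dualBracketL δ ξ η) ζ t := by
  induction t with
  | zero => simp
  | tmul a c => simp [deltaExt, ev3_assoc, D_apply]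
  | add a c h1 h2 => simp only [map_add, h1, h2]

lemma ev4_delta4 (δ : M →ₗ[K] M ⊗[K] M) (ξ η ζ θ : Module.Dual K M) (t : M ⊗[K] (M ⊗[K] M)) :
    ev4 ξ η ζ θ (delta4 δ t) = ev3 (dualBracketL δ ξ η) ζ θ t + ev3 ξ (dualBracketL δ η ζ) θ t
      + ev3 ξ η (dualBracketL δ ζ θ) t := by
  have : ev4 ξ η ζ θ ∘ₗ delta4 δ = ev3 (dualBracketL δ ξ η) ζ θ + ev3 ξ (dualBracketL δ η ζ) θ
      + ev3 ξ η (dualBracketL δ ζ θ) := ev3_ext fun a c d => by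
    simp [delta4, ev4_assoc, ev3_deltaExt, D_apply]
  exact LinearMap.congr_fun this t

/-- contraction `η ↦ x ↦ (η ⊗ id) (δ x)` -/
def S (δ : M →ₗ[K] M ⊗[K] M) : Module.Dual K M →ₗ[K] M →ₗ[K] M :=
  LinearMap.mk₂ K (fun η x => TensorProduct.lid K M (LinearMap.rTensor M η (δ x)))
    (by intros; simp [LinearMap.rTensor_add]) (by intros; simp [LinearMap.rTensor_smul])
    (by intros; simp) (by intros; simp)

lemma S_apply (δ : M →ₗ[K] M ⊗[K] M) (η ζ : Module.Dual K M) (x : M) :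
    ζ (S δ η x) = dualBracketL δ η ζ x := by
  rw [D_apply]
  show ζ (TensorProduct.lid K M (LinearMap.rTensor M η (δ x))) = _
  generalize δ x = t
  induction t with
  | zero => simp
  | tmul a c => simp
  | add a c h1 h2 => simp only [map_add, h1, h2]

def P (φ : M ⊗[K] (M ⊗[K] M)) : Module.Dual K M →ₗ[K] Module.Dual K M →ₗ[K] M :=
  LinearMap.mk₂ K (fun ξ η => TensorProduct.lid K M (LinearMap.rTensor M η
      (TensorProduct.lid K _ (LinearMap.rTensor (M ⊗[K] M) ξ φ))))
    (by intros; simp [LinearMap.rTensor_add]) (by intros; simp [LinearMap.rTensor_smul])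
    (by intros; simp [LinearMap.rTensor_add]) (by intros; simp [LinearMap.rTensor_smul])

lemma P_apply (φ : M ⊗[K] (M ⊗[K] M)) (ξ η ζ : Module.Dual K M) :
    ζ (P φ ξ η) = ev3 ξ η ζ φ := by
  show ζ (TensorProduct.lid K M (LinearMap.rTensor M η
      (TensorProduct.lid K _ (LinearMap.rTensor (M ⊗[K] M) ξ φ)))) = _
  have : ζ ∘ₗ (TensorProduct.lid K M).toLinearMap ∘ₗ LinearMap.rTensor M η ∘ₗ
      (TensorProduct.lid K _).toLinearMap ∘ₗ LinearMap.rTensor (M ⊗[K] M) ξ = ev3 ξ η ζ :=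
    ev3_ext fun a c d => by simp
  exact LinearMap.congr_fun this φ

/-- coadjoint-type action `E ξ x = ξ ∘ b x` -/
def E (b : M →ₗ[K] M →ₗ[K] M) : Module.Dual K M →ₗ[K] M →ₗ[K] Module.Dual K M :=
  LinearMap.mk₂ K (fun ξ x => ξ ∘ₗ b x)
    (by intros; ext; simp) (by intros; ext; simp) (by intros; ext; simp) (by intros; ext; simp)

lemma E_apply (b : M →ₗ[K] M →ₗ[K] M) (ξ : Module.Dual K M) (x y : M) :
    E b ξ x y = ξ (b x y) := rfl

/-- the bracket on the double -/
def Br (b : M →ₗ[K] M →ₗ[K] M) (δ : M →ₗ[K] M ⊗[K] M) (φ : M ⊗[K] (M ⊗[K] M)) :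
    (M × Module.Dual K M) →ₗ[K] (M × Module.Dual K M) →ₗ[K] (M × Module.Dual K M) :=
  LinearMap.mk₂ K (fun u v =>
    (b u.1 v.1 + S δ v.2 u.1 - S δ u.2 v.1 - (2 : K) • P φ u.2 v.2,
      dualBracketL δ u.2 v.2 - E b v.2 u.1 + E b u.2 v.1))
    (by intros; ext1 <;> simp <;> module)
    (by intros; ext1 <;> simp <;> module)
    (by intros; ext1 <;> simp <;> module)
    (by intros; ext1 <;> simp <;> module)

lemma Br_apply (b : M →ₗ[K] M →ₗ[K] M) (δ : M →ₗ[K] M ⊗[K] M) (φ : M ⊗[K] (M ⊗[K] M))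
    (u v : M × Module.Dual K M) : Br b δ φ u v =
    (b u.1 v.1 + S δ v.2 u.1 - S δ u.2 v.1 - (2 : K) • P φ u.2 v.2,
      dualBracketL δ u.2 v.2 - E b v.2 u.1 + E b u.2 v.1) := rfl

end QB

set_option linter.unusedSimpArgs false

/-- A finite-dimensional Lie quasi-bialgebra `(V, b, δ, φ)` over a field of
characteristic zero gives rise to a Lie bracket `B` on `g = V × V*` restricting to `b` on
`V × {0}`, whose `V*`-component on `{0} × V*` is the dual bracket of `δ`, and for which
the canonical symmetric form is invariant.  In particular `(g, V × {0})` is a Manin pair: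
`V × {0}` is a Lie subalgebra of `(g, B)` that is isotropic for the canonical form. -/
theorem statement10 {K : Type*} [Field K] [CharZero K] {V : Type*} [AddCommGroup V]
    [Module K V] [FiniteDimensional K V]
    (b : V →ₗ[K] V →ₗ[K] V) (δ : V →ₗ[K] V ⊗[K] V) (φ : V ⊗[K] (V ⊗[K] V))
    (hb : IsLieBracket b) (hanti : CoAnti δ) (hcoc : Cocycle b δ)
    (hφ12 : swap12 K V φ = -φ) (hφ23 : swap23 K V φ = -φ)
    (hmodcojac : ∀ x : V,
      ((LinearMap.id + sigmaMap K V + sigmaMap K V ∘ₗ sigmaMap K V :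
          V ⊗[K] (V ⊗[K] V) →ₗ[K] V ⊗[K] (V ⊗[K] V))) (deltaExt δ (δ x)) =
        (2 : K) • adT3 b x φ)
    (hδφ : delta4 δ φ = 0) :
    ∃ B : (V × Module.Dual K V) →ₗ[K] (V × Module.Dual K V) →ₗ[K] (V × Module.Dual K V),
      (∀ u, B u u = 0) ∧
      (∀ u v w, B (B u v) w + B (B v w) u + B (B w u) v = 0) ∧
      (∀ x y : V, B (x, 0) (y, 0) = (b x y, 0)) ∧
      (∀ ξ η : Module.Dual K V, (B (0, ξ) (0, η)).2 = dualBracketL δ ξ η) ∧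
      (∀ u v w, canForm (B u v) w = - canForm v (B u w)) ∧
      (∀ u ∈ Submodule.fst K V (Module.Dual K V), ∀ v ∈ Submodule.fst K V (Module.Dual K V),
        B u v ∈ Submodule.fst K V (Module.Dual K V)) ∧
      (∀ u ∈ Submodule.fst K V (Module.Dual K V), ∀ v ∈ Submodule.fst K V (Module.Dual K V),
        canForm u v = 0) := by
  obtain ⟨hb1, hb2⟩ := hb
  have hbs : ∀ x y, b x y = - b y x := fun x y => by
    have h := hb1 (x + y)
    simp only [map_add, LinearMap.add_apply, hb1, zero_add, add_zero] at h
    exact eq_neg_of_add_eq_zero_right h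
  have hD : ∀ ξ η, dualBracketL δ η ξ = - dualBracketL δ ξ η := fun ξ η => by
    ext x
    have h := congrArg (QB.ev2 η ξ) (LinearMap.congr_fun hanti x)
    simp only [tauMap, LinearMap.comp_apply, LinearEquiv.coe_coe, QB.ev2_tau, LinearMap.neg_apply,
      map_neg] at h
    simp only [LinearMap.neg_apply, QB.D_apply, h, neg_neg]
  have hf12 : ∀ ξ η ζ, QB.ev3 η ξ ζ φ = - QB.ev3 ξ η ζ φ := fun ξ η ζ => by
    rw [← QB.ev3_swap12, hφ12, map_neg]
  have hf23 : ∀ ξ η ζ, QB.ev3 ξ ζ η φ = - QB.ev3 ξ η ζ φ := fun ξ η ζ => by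
    rw [← QB.ev3_swap23, hφ23, map_neg]
  have hfneg : ∀ ξ η ζ, QB.ev3 ξ η (-ζ) φ = - QB.ev3 ξ η ζ φ := fun ξ η ζ => by
    rw [← QB.P_apply, ← QB.P_apply, LinearMap.neg_apply]
  have hfneg1 : ∀ ξ η ζ, QB.ev3 (-ξ) η ζ φ = - QB.ev3 ξ η ζ φ := fun ξ η ζ => by
    rw [← QB.P_apply, ← QB.P_apply, map_neg, LinearMap.neg_apply, map_neg]
  have hfneg2 : ∀ ξ η ζ, QB.ev3 ξ (-η) ζ φ = - QB.ev3 ξ η ζ φ := fun ξ η ζ => by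
    rw [← QB.P_apply, ← QB.P_apply, map_neg, map_neg]
  have hE : ∀ (ξ : Module.Dual K V) x, ξ ∘ₗ b x = QB.E b ξ x := fun _ _ => rfl
  have hC : ∀ ξ η x y, dualBracketL δ ξ η (b x y) =
      dualBracketL δ (QB.E b ξ x) η y + dualBracketL δ ξ (QB.E b η x) y
      - dualBracketL δ (QB.E b ξ y) η x - dualBracketL δ ξ (QB.E b η y) x := fun ξ η x y => by
    simp only [QB.D_apply, hcoc x y, map_sub, QB.ev2_adT, hE]
    ring
  have hJ : ∀ ξ η ζ x, dualBracketL δ (dualBracketL δ ξ η) ζ x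
      + dualBracketL δ (dualBracketL δ ζ ξ) η x + dualBracketL δ (dualBracketL δ η ζ) ξ x =
      2 * (QB.ev3 (QB.E b ξ x) η ζ φ + QB.ev3 ξ (QB.E b η x) ζ φ + QB.ev3 ξ η (QB.E b ζ x) φ) := by
    intro ξ η ζ x
    have h := congrArg (QB.ev3 ξ η ζ) (hmodcojac x)
    simp only [LinearMap.add_apply, LinearMap.comp_apply, LinearMap.id_apply, map_add, map_smul,
      QB.ev3_sigma, QB.ev3_deltaExt, QB.ev3_adT3, hE, smul_eq_mul] at h
    simpa only [QB.D_apply (x := x)] using h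
  have h4 : ∀ ξ η ζ θ, QB.ev3 (dualBracketL δ ξ η) ζ θ φ + QB.ev3 ξ (dualBracketL δ η ζ) θ φ
      + QB.ev3 ξ η (dualBracketL δ ζ θ) φ = 0 := fun ξ η ζ θ => by
    rw [← QB.ev4_delta4, hδφ, map_zero]
  have hSb : ∀ (θ η : Module.Dual K V) x z, θ (b (QB.S δ η x) z) =
      - dualBracketL δ η (QB.E b θ z) x := fun θ η x z => by
    rw [hbs, map_neg, ← QB.E_apply, QB.S_apply]
  have hPb : ∀ (θ ξ η : Module.Dual K V) z, θ (b (QB.P φ ξ η) z) =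
      - QB.ev3 ξ η (QB.E b θ z) φ := fun θ ξ η z => by
    rw [hbs, map_neg, ← QB.E_apply, QB.P_apply]
  have hbL : ∀ (θ : Module.Dual K V) y z t, θ (b (b y z) t) = θ (b y (b z t)) - θ (b z (b y t)) := by
    intro θ y z t
    have h := congrArg θ (hb2 y z t)
    rw [hbs (b z t) y, hbs (b t y) z, hbs t y] at h
    simp only [map_add, map_neg, map_zero, neg_neg] at h
    linear_combination h
  -- normalisation rules
  have n1 : ∀ ξ η x, dualBracketL δ (QB.E b ξ x) η = - dualBracketL δ η (QB.E b ξ x) :=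
    fun _ _ _ => hD _ _
  have n2 : ∀ ξ η ζ, dualBracketL δ (dualBracketL δ ξ η) ζ = - dualBracketL δ ζ (dualBracketL δ ξ η) :=
    fun _ _ _ => hD _ _
  have n3 : ∀ ξ x η ζ, QB.ev3 (QB.E b ξ x) η ζ φ = QB.ev3 η ζ (QB.E b ξ x) φ := fun ξ x η ζ => by
    rw [hf12, hf23, neg_neg]
  have n4 : ∀ ξ x η ζ, QB.ev3 η (QB.E b ξ x) ζ φ = - QB.ev3 η ζ (QB.E b ξ x) φ := fun ξ x η ζ => by
    rw [hf23]
  have n5 : ∀ ξ x η ζ, QB.ev3 (dualBracketL δ ξ x) η ζ φ = QB.ev3 η ζ (dualBracketL δ ξ x) φ :=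
    fun ξ x η ζ => by rw [hf12, hf23, neg_neg]
  have n6 : ∀ ξ x η ζ, QB.ev3 η (dualBracketL δ ξ x) ζ φ = - QB.ev3 η ζ (dualBracketL δ ξ x) φ :=
    fun ξ x η ζ => by rw [hf23]
  refine ⟨QB.Br b δ φ, ?_, ?_, ?_, ?_, ?_, ?_, ?_⟩
  · rintro ⟨x, ξ⟩
    have e1 : dualBracketL δ ξ ξ = 0 := by
      ext t
      exact self_eq_neg.mp (LinearMap.congr_fun (hD ξ ξ) t)
    have e2 : QB.P φ ξ ξ = 0 := by
      rw [← Module.forall_dual_apply_eq_zero_iff K]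
      intro θ
      rw [QB.P_apply]
      exact self_eq_neg.mp (hf12 ξ ξ θ)
    simp [QB.Br_apply, hb1, e1, e2]
  · rintro ⟨x, ξ⟩ ⟨y, η⟩ ⟨z, ζ⟩
    ext1
    · rw [← sub_eq_zero, ← Module.forall_dual_apply_eq_zero_iff K]
      intro θ
      have o1 := hD ξ η
      have o2 := hD ξ ζ
      have o3 := hD ξ θ
      have o4 := hD η ζ
      have o5 := hD η θ
      have o6 := hD ζ θ
      have q1 := hf12 ξ η
      have q2 := hf12 ξ ζ
      have q3 := hf12 ξ θ
      have q4 := hf12 η ζ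
      have q5 := hf12 η θ
      have q6 := hf12 ζ θ
      have j1 := hJ η ζ θ x
      have j2 := hJ ζ ξ θ y
      have j3 := hJ ξ η θ z
      have k1 := h4 ξ η ζ θ
      have k2 := h4 η ζ ξ θ
      have k3 := h4 ζ ξ η θ
      have k4 := h4 η ξ ζ θ
      have k5 := h4 ξ ζ η θ
      have k7 := h4 ζ θ ξ η
      have k8 := h4 ξ θ η ζ
      have k9 := h4 η θ ζ ξ
      have k6 := h4 ζ η ξ θ
      have hbJ := congrArg θ (hb2 x y z)
      simp only [n1, n2, n3, n4, n5, n6, o1, o2, o3, o4, o5, o6, q1, q2, q3, q4, q5, q6, hfneg, hfneg1, hfneg2,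
        LinearMap.neg_apply, map_neg, map_add, map_zero] at j1 j2 j3 k1 k2 k3 k4 k5 k6 k7 k8 k9 hbJ
      simp only [QB.Br_apply, Prod.fst_add, Prod.snd_add, Prod.fst_zero, sub_zero, map_add, map_sub,
        map_smul, LinearMap.add_apply, LinearMap.sub_apply, LinearMap.smul_apply, QB.S_apply,
        QB.P_apply, hSb, hPb, hC, smul_eq_mul, QB.E_apply]
      simp only [n1, n2, n3, n4, n5, n6, o1, o2, o3, o4, o5, o6, q1, q2, q3, q4, q5, q6, hfneg, hfneg1, hfneg2,
        LinearMap.neg_apply, map_neg]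
      clear hb1 hb2 hbs hD hf12 hf23 hfneg hfneg1 hfneg2 hE hC hJ h4 hSb hPb hbL n1 n2 n3 n4 n5 n6 hmodcojac hδφ hφ12 hφ23 hanti hcoc o1 o2 o3 o4 o5 o6 q1 q2 q3 q4 q5 q6
      grind
    · ext t
      have o1 := hD ξ η
      have o2 := hD ξ ζ
      have o4 := hD η ζ
      have q1 := hf12 ξ η
      have q2 := hf12 ξ ζ
      have q4 := hf12 η ζ
      have j1 := hJ ξ η ζ t
      simp only [n1, n2, n3, n4, n5, n6, o1, o2, o4, q1, q2, q4, hfneg, hfneg1, hfneg2,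
        LinearMap.neg_apply, map_neg, map_add] at j1
      simp only [QB.Br_apply, Prod.fst_add, Prod.snd_add, Prod.snd_zero, map_add, map_sub,
        map_smul, LinearMap.add_apply, LinearMap.sub_apply, LinearMap.smul_apply, QB.S_apply,
        QB.P_apply, hSb, hPb, hC, smul_eq_mul, QB.E_apply, LinearMap.zero_apply]
      simp only [n1, n2, n3, n4, n5, n6, o1, o2, o4, q1, q2, q4, hfneg, hfneg1, hfneg2,
        LinearMap.neg_apply, map_neg, hbL]
      clear hb1 hb2 hbs hD hf12 hf23 hfneg hfneg1 hfneg2 hE hC hJ h4 hSb hPb hbL n1 n2 n3 n4 n5 n6 hmodcojac hδφ hφ12 hφ23 hanti hcoc o1 o2 o4 q1 q2 q4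
      grind
  · intro x y
    simp [QB.Br_apply]
  · intro ξ η
    simp [QB.Br_apply]
  · rintro ⟨x, ξ⟩ ⟨y, η⟩ ⟨z, ζ⟩
    have s1 := congrArg ξ (hbs y z)
    have d1 := LinearMap.congr_fun (hD ξ η) z
    have d2 := LinearMap.congr_fun (hD ξ ζ) y
    have d3 := LinearMap.congr_fun (hD η ζ) x
    have q := hf23 ξ η ζ
    simp only [LinearMap.neg_apply, map_neg] at s1 d1 d2 d3
    simp only [canForm, QB.Br_apply, map_add, map_sub, map_smul, LinearMap.add_apply,
      LinearMap.sub_apply, QB.S_apply, QB.P_apply, smul_eq_mul, QB.E_apply]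
    clear hb1 hb2 hbs hD hf12 hf23 hfneg hfneg1 hfneg2 hE hC hJ h4 hSb hPb hbL n1 n2 n3 n4 n5 n6 hmodcojac hδφ hφ12 hφ23 hanti hcoc 
    grind
  · rintro ⟨x, ξ⟩ hu ⟨y, η⟩ hv
    simp only [Submodule.fst, Submodule.mem_comap, Submodule.mem_bot, LinearMap.snd_apply] at hu hv
    subst hu hv
    simp [QB.Br_apply, Submodule.fst]
  · rintro ⟨x, ξ⟩ hu ⟨y, η⟩ hv
    simp only [Submodule.fst, Submodule.mem_comap, Submodule.mem_bot, LinearMap.snd_apply] at hu hv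
    subst hu hv
    simp [canForm]
end
end
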